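/- arXiv:2110.13186 — 2 statements merged into one kernel-verified Lean document; each statement's English description precedes it below -/
import Mathlib

section
/- Assume char K ≠ 2 and X is a connected locally finite poset satisfying conditions (M) and (D). Let λ be an involution on X with exactly one fixed point. Then every involution Φ on D(X,K) of the form Φ = Ψ_θ ∘ ρ̃_λ ∘ (k̃δ), with θ a unit of D(X,K) and k ∈ {−1,1}, is equivalent via an inner automorphism to ρ̃_λ ∘ (k̃δ): there exists a unit γ of D(X,K) such that Ψ_γ ∘ Φ = (ρ̃_λ ∘ (k̃δ)) ∘ Ψ_γ. -/
open TrivSqZeroExt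

variable (K X : Type*) [Field K] [PartialOrder X] [LocallyFiniteOrder X] [DecidableEq X]

/-- The anti-automorphism `ρ_λ` of the incidence algebra induced by an order
anti-automorphism `lam` of `X`: `ρ_λ(f)(x,y) = f(λ(y), λ(x))`. -/
def rhoLam (lam : X → X) (hlam : ∀ x y : X, x ≤ y ↔ lam y ≤ lam x)
    (f : IncidenceAlgebra K X) : IncidenceAlgebra K X :=
  ⟨fun x y => f (lam y) (lam x), fun x y hxy =>
    IncidenceAlgebra.apply_eq_zero_of_not_le (fun h => hxy ((hlam x y).mpr h)) f⟩

/-- The anti-automorphism `ρ̃_λ` of `D(X,K)`: `(f,i) ↦ (ρ_λ(f), ρ_λ(i))`. -/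
def rhoTilde (lam : X → X) (hlam : ∀ x y : X, x ≤ y ↔ lam y ≤ lam x)
    (d : TrivSqZeroExt (IncidenceAlgebra K X) (IncidenceAlgebra K X)) :
    TrivSqZeroExt (IncidenceAlgebra K X) (IncidenceAlgebra K X) :=
  inl (rhoLam K X lam hlam d.fst) + inr (rhoLam K X lam hlam d.snd)

/-- The automorphism `k̃δ` of `D(X,K)`: `(f,i) ↦ (f, k·i)`. -/
def kTilde (k : K) (d : TrivSqZeroExt (IncidenceAlgebra K X) (IncidenceAlgebra K X)) :
    TrivSqZeroExt (IncidenceAlgebra K X) (IncidenceAlgebra K X) :=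
  inl d.fst + inr (k • d.snd)

/-- Condition (M): every multiplicative automorphism of `I(X,K)` is inner. -/
def CondM : Prop :=
  ∀ σ : X → X → K, (∀ x y : X, x ≤ y → σ x y ≠ 0) →
    (∀ x y z : X, x ≤ y → y ≤ z → σ x y * σ y z = σ x z) →
    ∃ u : (IncidenceAlgebra K X)ˣ, ∀ (f : IncidenceAlgebra K X) (x y : X), x ≤ y →
      (↑u * f * ↑u⁻¹ : IncidenceAlgebra K X) x y = σ x y * f x y

/-- Condition (D): every `K`-linear derivation of `I(X,K)` is inner. -/
def CondD : Prop :=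
  ∀ Der : IncidenceAlgebra K X → IncidenceAlgebra K X,
    (∀ f g, Der (f + g) = Der f + Der g) →
    (∀ (k : K) (f : IncidenceAlgebra K X), Der (k • f) = k • Der f) →
    (∀ f g, Der (f * g) = Der f * g + f * Der g) →
    ∃ i : IncidenceAlgebra K X, ∀ f, Der f = f * i - i * f

/-- Connectedness of the poset `X`. -/
def PosetConnected : Prop :=
  ∀ x y : X, Relation.ReflTransGen (fun a b : X => a ≤ b ∨ b ≤ a) x y

section Conjugation

variable {M : Type*} [Monoid M] {σ : M → M}

/-- If `d ↦ θ σ(d) θ⁻¹` is involutive for an anti-involution `σ`, then `θ` is `σ`-symmetric up to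
a central factor. -/
lemma exists_central_eq_mul_of_involutive (σ_one : σ 1 = 1) (σ_mul : ∀ a b, σ (a * b) = σ b * σ a)
    (σ_σ : ∀ a, σ (σ a) = a) (θ : Mˣ)
    (h : ∀ d, ↑θ * σ (↑θ * σ d * ↑θ⁻¹) * ↑θ⁻¹ = d) :
    ∃ c : M, (∀ d, c * d = d * c) ∧ ↑θ = c * σ θ := by
  have hθ : σ θ * σ ↑θ⁻¹ = 1 := by rw [← σ_mul, Units.inv_mul, σ_one]
  have hθ' : σ ↑θ⁻¹ * σ θ = 1 := by rw [← σ_mul, Units.mul_inv, σ_one]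
  refine ⟨θ * σ ↑θ⁻¹, fun d => ?_, by rw [mul_assoc, hθ', mul_one]⟩
  have hd := h d
  rw [σ_mul, σ_mul, σ_σ] at hd
  calc ↑θ * σ ↑θ⁻¹ * d = ↑θ * σ ↑θ⁻¹ * d * (σ θ * (↑θ⁻¹ * ↑θ) * σ ↑θ⁻¹) := by
        rw [Units.inv_mul, mul_one, hθ, mul_one]
    _ = ↑θ * (σ ↑θ⁻¹ * (d * σ θ)) * ↑θ⁻¹ * (↑θ * σ ↑θ⁻¹) := by simp only [mul_assoc]
    _ = d * (↑θ * σ ↑θ⁻¹) := by rw [hd]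

/-- If `θ = η c σ(η)` with `c` central, then conjugation by `η⁻¹` transports
`d ↦ θ σ(d) θ⁻¹` to `σ`. -/
lemma conj_inv_eq_of_eq_mul_central_mul (σ_one : σ 1 = 1)
    (σ_mul : ∀ a b, σ (a * b) = σ b * σ a) (θ η : Mˣ) {c : M} (hc : ∀ d, c * d = d * c)
    (h : (θ : M) = η * c * σ η) (d : M) :
    ↑η⁻¹ * (↑θ * σ d * ↑θ⁻¹) * ↑η = σ (↑η⁻¹ * d * ↑η) := by
  have hη : σ ↑η⁻¹ * σ η = 1 := by rw [← σ_mul, Units.mul_inv, σ_one]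
  have key : ↑η⁻¹ * ↑θ = c * σ η := by rw [h, mul_assoc, Units.inv_mul_cancel_left]
  rw [σ_mul, σ_mul]
  calc ↑η⁻¹ * (↑θ * σ d * ↑θ⁻¹) * ↑η
      = ↑η⁻¹ * ↑θ * σ d * (↑θ⁻¹ * ↑η) := by simp only [mul_assoc]
    _ = c * (σ η * (σ d * (σ ↑η⁻¹ * σ η))) * (↑θ⁻¹ * ↑η) := by
        rw [key, hη, mul_one, mul_assoc c]
    _ = σ η * (σ d * σ ↑η⁻¹) * (c * σ η) * (↑θ⁻¹ * ↑η) := by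
        rw [← mul_assoc (σ η * _) c, ← hc]
        simp only [mul_assoc]
    _ = σ η * (σ d * σ ↑η⁻¹) := by
        rw [← key]
        simp [mul_assoc]

end Conjugation

namespace IncidenceAlgebra

variable {K X}

section Diagonal

/-- The diagonal element of the incidence algebra with the given entries. -/
def diag (d : X → K) : IncidenceAlgebra K X :=
  ⟨fun a b => if a = b then d a else 0, fun _ _ h => if_neg fun e => h e.le⟩

omit [LocallyFiniteOrder X] in
lemma diag_apply (d : X → K) (a b : X) : diag d a b = if a = b then d a else 0 := rfl

lemma diag_mul_apply (d : X → K) (f : IncidenceAlgebra K X) (a b : X) :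
    (diag d * f) a b = d a * f a b := by
  by_cases hab : a ≤ b
  · simp [diag_apply, hab]
  · simp [apply_eq_zero_of_not_le hab]

lemma mul_diag_apply (d : X → K) (f : IncidenceAlgebra K X) (a b : X) :
    (f * diag d) a b = f a b * d b := by
  by_cases hab : a ≤ b
  · simp [diag_apply, hab]
  · simp [apply_eq_zero_of_not_le hab]

lemma isUnit_diag {d : X → K} (hd : ∀ x, d x ≠ 0) : IsUnit (diag d) := by
  refine ⟨⟨diag d, diag fun x => (d x)⁻¹, ?_, ?_⟩, rfl⟩ <;>
  · ext a b _
    rw [diag_mul_apply, diag_apply, one_apply]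
    split_ifs <;> simp [hd]

lemma apply_self_ne_zero {u : IncidenceAlgebra K X} (hu : IsUnit u) (x : X) : u x x ≠ 0 := by
  obtain ⟨v, hv⟩ := hu.exists_right_inv
  have h := congrArg (fun f : IncidenceAlgebra K X => f x x) hv
  simp only [mul_apply, Finset.Icc_self, Finset.sum_singleton, one_apply, if_true] at h
  exact left_ne_zero_of_mul_eq_one h

end Diagonal

section Center

/-- The matrix unit at a pair `x ≤ y`. -/
def single {x y : X} (h : x ≤ y) : IncidenceAlgebra K X :=
  ⟨fun a b => if a = x ∧ b = y then 1 else 0, fun a b hab =>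
    if_neg fun (e : a = x ∧ b = y) => hab (by rwa [e.1, e.2])⟩

omit [LocallyFiniteOrder X] in
lemma single_apply {x y : X} (h : x ≤ y) (a b : X) :
    (single h : IncidenceAlgebra K X) a b = if a = x ∧ b = y then 1 else 0 := rfl

lemma mul_single_apply {x y : X} (h : x ≤ y) (f : IncidenceAlgebra K X) :
    (f * single h : IncidenceAlgebra K X) x y = f x x := by
  rw [mul_apply, Finset.sum_eq_single x] <;> simp +contextual [single_apply, h]

lemma single_mul_apply {x y : X} (h : x ≤ y) (f : IncidenceAlgebra K X) :
    (single h * f : IncidenceAlgebra K X) x y = f y y := by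
  rw [mul_apply, Finset.sum_eq_single y] <;> simp +contextual [single_apply, h]

/-- A central element of the incidence algebra of a connected poset is a scalar. -/
lemma exists_eq_smul_one_of_central (hconn : PosetConnected X) (x₀ : X)
    {z : IncidenceAlgebra K X} (hz : ∀ f, z * f = f * z) : ∃ a : K, z = a • 1 := by
  have hstep : ∀ x y, x ≤ y → z x x = z y y := fun x y h => by
    rw [← mul_single_apply h, hz, single_mul_apply]
  have hdiag : ∀ y, z x₀ x₀ = z y y := fun y => by
    induction hconn x₀ y with
    | refl => rfl
    | tail _ h ih => exact ih.trans (h.elim (hstep _ _) fun h => (hstep _ _ h).symm)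
  refine ⟨z x₀ x₀, ?_⟩
  ext x y hxy
  rw [constSMul_apply, one_apply]
  split_ifs with h
  · subst h
    simpa using (hdiag x).symm
  · have h' := congrArg (fun f : IncidenceAlgebra K X => f x y)
      (hz (diag fun t => if t = x then 1 else 0))
    simp only [mul_diag_apply, diag_mul_apply, if_true, if_neg (Ne.symm h)] at h'
    simpa using h'.symm

end Center

section SquareRoot

omit [DecidableEq X] in
lemma mul_apply_of_lt {x y : X} (h : x < y) (f g : IncidenceAlgebra K X) :
    (f * g) x y = f x x * g x y + f x y * g y y + ∑ z ∈ Finset.Ioo x y, f x z * g z y := by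
  rw [mul_apply, ← Finset.sum_Ioc_add_eq_sum_Icc h.le, ← Finset.sum_Ioo_add_eq_sum_Ioc h]
  ring

/-- The entries of the square root of an element with unit diagonal, defined by recursion on
intervals. -/
def sqrtFun (u : IncidenceAlgebra K X) (a b : X) : K :=
  if a = b then 1
  else (u a b - ∑ z ∈ (Finset.Ioo a b).attach,
    have h := Finset.mem_Ioo.1 z.2
    have : (Finset.Icc a z.1).card < (Finset.Icc a b).card := Finset.card_lt_card
      (Finset.Icc_ssubset_Icc_right (h.1.le.trans h.2.le) le_rfl h.2)
    have : (Finset.Icc z.1 b).card < (Finset.Icc a b).card := Finset.card_lt_card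
      (Finset.Icc_ssubset_Icc_left (h.1.le.trans h.2.le) h.1 le_rfl)
    sqrtFun u a z * sqrtFun u z b) / 2
termination_by (Finset.Icc a b).card

lemma sqrtFun_self (u : IncidenceAlgebra K X) (a : X) : sqrtFun u a a = 1 := by
  rw [sqrtFun, if_pos rfl]

lemma sqrtFun_of_ne (u : IncidenceAlgebra K X) {a b : X} (h : a ≠ b) :
    sqrtFun u a b = (u a b - ∑ z ∈ Finset.Ioo a b, sqrtFun u a z * sqrtFun u z b) / 2 := by
  rw [sqrtFun, if_neg h, ← Finset.sum_attach (Finset.Ioo a b)]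

/-- The square root of an element with unit diagonal. -/
def sqrt (u : IncidenceAlgebra K X) : IncidenceAlgebra K X :=
  ⟨sqrtFun u, fun a b h => by
    rw [sqrtFun_of_ne u fun e => h e.le, apply_eq_zero_of_not_le h,
      Finset.Ioo_eq_empty fun e => h e.le]
    simp⟩

lemma sqrt_apply_self (u : IncidenceAlgebra K X) (a : X) : sqrt u a a = 1 := sqrtFun_self u a

lemma sqrt_mul_sqrt (h2 : (2 : K) ≠ 0) {u : IncidenceAlgebra K X} (hu : ∀ x, u x x = 1) :
    sqrt u * sqrt u = u := by
  ext a b hab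
  obtain rfl | h := eq_or_ne a b
  · simp [sqrt_apply_self, hu]
  · have : sqrt u a b = (u a b - ∑ z ∈ Finset.Ioo a b, sqrt u a z * sqrt u z b) / 2 :=
      sqrtFun_of_ne u h
    rw [mul_apply_of_lt (lt_of_le_of_ne hab h), sqrt_apply_self, sqrt_apply_self]
    rw [eq_div_iff h2] at this
    linear_combination this

omit [DecidableEq X] in
/-- Square roots with unit diagonal are unique. -/
lemma eq_of_mul_self_eq (h2 : (2 : K) ≠ 0) {f g : IncidenceAlgebra K X} (hf : ∀ x, f x x = 1)
    (hg : ∀ x, g x x = 1) (h : f * f = g * g) : f = g := by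
  suffices H : ∀ n a b, (Finset.Icc a b).card = n → a ≤ b → f a b = g a b by
    ext a b hab
    exact H _ a b rfl hab
  intro n
  induction n using Nat.strong_induction_on with
  | _ n ih =>
    rintro a b rfl hab
    obtain rfl | hne := eq_or_ne a b
    · rw [hf, hg]
    · have hlt := lt_of_le_of_ne hab hne
      have e := congrArg (fun f : IncidenceAlgebra K X => f a b) h
      simp only [mul_apply_of_lt hlt, hf, hg] at e
      have hsum : ∑ z ∈ Finset.Ioo a b, f a z * f z b = ∑ z ∈ Finset.Ioo a b, g a z * g z b := by
        refine Finset.sum_congr rfl fun z hz => ?_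
        obtain ⟨h₁, h₂⟩ := Finset.mem_Ioo.1 hz
        rw [ih _ (Finset.card_lt_card (Finset.Icc_ssubset_Icc_right hab le_rfl h₂)) a z rfl h₁.le,
          ih _ (Finset.card_lt_card (Finset.Icc_ssubset_Icc_left hab h₁ le_rfl)) z b rfl h₂.le]
      rw [hsum] at e
      refine mul_left_cancel₀ h2 ?_
      linear_combination e

end SquareRoot

section AntiInvolution

variable {lam : X → X} (hlam : ∀ x y : X, x ≤ y ↔ lam y ≤ lam x)

omit [LocallyFiniteOrder X] [DecidableEq X] in
lemma rhoLam_apply (f : IncidenceAlgebra K X) (x y : X) :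
    rhoLam K X lam hlam f x y = f (lam y) (lam x) := rfl

lemma rhoLam_smul (a : K) (f : IncidenceAlgebra K X) :
    rhoLam K X lam hlam (a • f) = a • rhoLam K X lam hlam f := rfl

omit [LocallyFiniteOrder X] [DecidableEq X] in
lemma rhoLam_add (f g : IncidenceAlgebra K X) :
    rhoLam K X lam hlam (f + g) = rhoLam K X lam hlam f + rhoLam K X lam hlam g := rfl

variable (hinv : ∀ x : X, lam (lam x) = x)
include hinv

omit [LocallyFiniteOrder X] [DecidableEq X] in
lemma rhoLam_rhoLam (f : IncidenceAlgebra K X) :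
    rhoLam K X lam hlam (rhoLam K X lam hlam f) = f := by
  ext x y _
  simp [rhoLam_apply, hinv]

omit [LocallyFiniteOrder X] in
lemma rhoLam_one : rhoLam K X lam hlam 1 = 1 := by
  ext x y _
  simp only [rhoLam_apply, one_apply, (Function.LeftInverse.injective hinv).eq_iff, eq_comm]

omit [DecidableEq X] in
lemma rhoLam_mul (f g : IncidenceAlgebra K X) :
    rhoLam K X lam hlam (f * g) = rhoLam K X lam hlam g * rhoLam K X lam hlam f := by
  ext x y _
  simp only [rhoLam_apply, mul_apply]
  refine Finset.sum_nbij' lam lam (fun z hz => ?_) (fun z hz => ?_) (fun z _ => hinv z)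
    (fun z _ => hinv z) fun z _ => by rw [hinv, mul_comm]
  · rw [Finset.mem_Icc] at hz ⊢
    rw [hlam x, hlam _ y, hinv]
    exact hz.symm
  · rw [Finset.mem_Icc] at hz ⊢
    rw [← hlam, ← hlam]
    exact hz.symm

omit [PartialOrder X] [LocallyFiniteOrder X] [DecidableEq X] in
lemma exists_mul_lam_eq {x₀ : X} (hfix : ∀ x, lam x = x → x = x₀) (e : X → K)
    (he : ∀ x, e x ≠ 0) (he_lam : ∀ x, e (lam x) = e x) (he₀ : e x₀ = 1) :
    ∃ d : X → K, (∀ x, d x ≠ 0) ∧ ∀ x, d x * d (lam x) = e x := by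
  classical
  refine ⟨fun x => if WellOrderingRel x (lam x) then e x else 1, fun x => ?_, fun x => ?_⟩
  · dsimp only
    split_ifs
    exacts [he x, one_ne_zero]
  · dsimp only
    rw [hinv, he_lam]
    rcases trichotomous_of WellOrderingRel x (lam x) with h | h | h
    · rw [if_pos h, if_neg (asymm h), mul_one]
    · rw [← h, if_neg (irrefl x), hfix x h.symm, he₀, mul_one]
    · rw [if_pos h, if_neg (asymm h), one_mul]

/-- A symmetric unit is, up to a scalar, of the form `v ρ(v)` when `lam` has exactly one fixed
point. -/
lemma exists_eq_smul_mul_rhoLam (h2 : (2 : K) ≠ 0) {x₀ : X}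
    (hfix : ∀ x, lam x = x → x = x₀) {u : IncidenceAlgebra K X} (hu : IsUnit u)
    (hsymm : rhoLam K X lam hlam u = u) :
    ∃ (s : K) (v : IncidenceAlgebra K X),
      s ≠ 0 ∧ IsUnit v ∧ u = s • (v * rhoLam K X lam hlam v) := by
  have hu' : ∀ a b, u (lam b) (lam a) = u a b := fun a b => by
    conv_rhs => rw [← hsymm, rhoLam_apply]
  set s := u x₀ x₀ with hs_def
  have hs : s ≠ 0 := apply_self_ne_zero hu x₀
  obtain ⟨d, hd, hdd⟩ := exists_mul_lam_eq hinv hfix (fun x => s⁻¹ * u x x)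
    (fun x => mul_ne_zero (inv_ne_zero hs) (apply_self_ne_zero hu x))
    (fun x => by simp only [hu']) (inv_mul_cancel₀ hs)
  set p := diag (fun x => s⁻¹ * (d x)⁻¹) * u * diag (fun x => (d (lam x))⁻¹) with hp_def
  have hp : ∀ a b, p a b = s⁻¹ * (d a)⁻¹ * u a b * (d (lam b))⁻¹ := fun a b => by
    rw [hp_def, mul_diag_apply, diag_mul_apply]
  have hp_unit : IsUnit p :=
    ((isUnit_diag fun x => mul_ne_zero (inv_ne_zero hs) (inv_ne_zero (hd x))).mul hu).mul
      (isUnit_diag fun x => inv_ne_zero (hd _))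
  have hp_one : ∀ x, p x x = 1 := fun x => by
    have := hdd x
    have h₁ := hd x
    have h₂ := hd (lam x)
    rw [hp]
    field_simp at this ⊢
    linear_combination -this
  have hp_symm : rhoLam K X lam hlam p = p := by
    ext a b _
    rw [rhoLam_apply, hp, hp, hu', hinv]
    ring
  have hw := sqrt_mul_sqrt h2 hp_one
  have hw_symm : rhoLam K X lam hlam (sqrt p) = sqrt p := by
    refine eq_of_mul_self_eq h2 (fun x => sqrt_apply_self p _) (fun x => sqrt_apply_self p _) ?_
    rw [← rhoLam_mul hlam hinv, hw, hp_symm]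
  refine ⟨s, diag d * sqrt p, hs, (isUnit_diag hd).mul ?_, ?_⟩
  · rw [← hw] at hp_unit
    exact ((Commute.refl _).isUnit_mul_iff.1 hp_unit).1
  · have hdiag : rhoLam K X lam hlam (diag d) = diag fun x => d (lam x) := by
      ext a b _
      simp only [rhoLam_apply, diag_apply, (Function.LeftInverse.injective hinv).eq_iff]
      by_cases h : a = b <;> simp [h, eq_comm]
    rw [rhoLam_mul hlam hinv, hw_symm, hdiag, mul_assoc, ← mul_assoc (sqrt p), hw]
    ext a b _
    rw [constSMul_apply, diag_mul_apply, mul_diag_apply, hp, smul_eq_mul]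
    have h₁ := hd a
    have h₂ := hd (lam b)
    field_simp

end AntiInvolution

end IncidenceAlgebra

section Idealization

variable {K X}

/-- The second component of a product in the idealization. -/
lemma idealization_snd_mul (d e : TrivSqZeroExt (IncidenceAlgebra K X) (IncidenceAlgebra K X)) :
    (d * e).snd = d.fst * e.snd + d.snd * e.fst := rfl

/-- A central element of `D(X,K)` for connected `X` has scalar components. -/
lemma exists_fst_snd_eq_smul_one_of_central (hconn : PosetConnected X) (x₀ : X)
    {c : TrivSqZeroExt (IncidenceAlgebra K X) (IncidenceAlgebra K X)}
    (hc : ∀ d, c * d = d * c) :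
    ∃ a b : K, c.fst = a • (1 : IncidenceAlgebra K X) ∧
      c.snd = b • (1 : IncidenceAlgebra K X) := by
  obtain ⟨a, ha⟩ := IncidenceAlgebra.exists_eq_smul_one_of_central hconn x₀ (z := c.fst)
    fun f => by simpa using congrArg TrivSqZeroExt.fst (hc (inl f))
  obtain ⟨b, hb⟩ := IncidenceAlgebra.exists_eq_smul_one_of_central hconn x₀ (z := c.snd)
    fun f => by
      simpa [idealization_snd_mul, -snd_mul] using congrArg TrivSqZeroExt.snd (hc (inl f))
  exact ⟨a, b, ha, hb⟩

lemma central_of_fst_snd_eq_smul_one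
    {c : TrivSqZeroExt (IncidenceAlgebra K X) (IncidenceAlgebra K X)} {a b : K}
    (ha : c.fst = a • (1 : IncidenceAlgebra K X)) (hb : c.snd = b • (1 : IncidenceAlgebra K X))
    (d : TrivSqZeroExt (IncidenceAlgebra K X) (IncidenceAlgebra K X)) : c * d = d * c := by
  refine TrivSqZeroExt.ext ?_ ?_
  · simp [ha]
  · rw [idealization_snd_mul, idealization_snd_mul, ha, hb]
    simp [add_comm]

variable {lam : X → X} (hlam : ∀ x y : X, x ≤ y ↔ lam y ≤ lam x)

lemma fst_rhoTilde_kTilde (k : K)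
    (d : TrivSqZeroExt (IncidenceAlgebra K X) (IncidenceAlgebra K X)) :
    (rhoTilde K X lam hlam (kTilde K X k d)).fst = rhoLam K X lam hlam d.fst := by
  simp [rhoTilde, kTilde]

lemma snd_rhoTilde_kTilde (k : K)
    (d : TrivSqZeroExt (IncidenceAlgebra K X) (IncidenceAlgebra K X)) :
    (rhoTilde K X lam hlam (kTilde K X k d)).snd = k • rhoLam K X lam hlam d.snd := by
  simp [rhoTilde, kTilde, IncidenceAlgebra.rhoLam_smul]

variable (hinv : ∀ x : X, lam (lam x) = x)
include hinv

lemma rhoTilde_kTilde_one (k : K) : rhoTilde K X lam hlam (kTilde K X k 1) = 1 := by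
  refine TrivSqZeroExt.ext ?_ ?_
  · rw [fst_rhoTilde_kTilde, fst_one, IncidenceAlgebra.rhoLam_one hlam hinv]
  · rw [snd_rhoTilde_kTilde, snd_one, ← IncidenceAlgebra.rhoLam_smul, smul_zero]
    rfl

lemma rhoTilde_kTilde_mul (k : K)
    (d e : TrivSqZeroExt (IncidenceAlgebra K X) (IncidenceAlgebra K X)) :
    rhoTilde K X lam hlam (kTilde K X k (d * e)) =
      rhoTilde K X lam hlam (kTilde K X k e) * rhoTilde K X lam hlam (kTilde K X k d) := by
  refine TrivSqZeroExt.ext ?_ ?_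
  · simp only [fst_rhoTilde_kTilde, fst_mul, IncidenceAlgebra.rhoLam_mul hlam hinv]
  · simp only [snd_rhoTilde_kTilde, idealization_snd_mul, fst_rhoTilde_kTilde,
      IncidenceAlgebra.rhoLam_add, IncidenceAlgebra.rhoLam_mul hlam hinv, smul_add,
      mul_smul_comm, smul_mul_assoc]
    exact add_comm _ _

lemma rhoTilde_kTilde_involutive {k : K} (hk : k * k = 1)
    (d : TrivSqZeroExt (IncidenceAlgebra K X) (IncidenceAlgebra K X)) :
    rhoTilde K X lam hlam (kTilde K X k (rhoTilde K X lam hlam (kTilde K X k d))) = d := by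
  refine TrivSqZeroExt.ext ?_ ?_
  · simp only [fst_rhoTilde_kTilde, IncidenceAlgebra.rhoLam_rhoLam hlam hinv]
  · simp only [snd_rhoTilde_kTilde, IncidenceAlgebra.rhoLam_smul, smul_smul, hk, one_smul,
      IncidenceAlgebra.rhoLam_rhoLam hlam hinv]

/-- When `lam` has exactly one fixed point, a unit which is symmetric up to a central factor has
the form `η c σ(η)` with `c` central, where `σ = ρ̃_λ ∘ k̃δ`. -/
lemma exists_eq_mul_central_mul_rhoTilde (h2 : (2 : K) ≠ 0) (hconn : PosetConnected X)
    {x₀ : X} (hx₀ : lam x₀ = x₀) (hfix : ∀ x, lam x = x → x = x₀) (k : K)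
    {θ c : TrivSqZeroExt (IncidenceAlgebra K X) (IncidenceAlgebra K X)} (hθ : IsUnit θ)
    (hc : ∀ d, c * d = d * c) (h : θ = c * rhoTilde K X lam hlam (kTilde K X k θ)) :
    ∃ (η : (TrivSqZeroExt (IncidenceAlgebra K X) (IncidenceAlgebra K X))ˣ)
      (z : TrivSqZeroExt (IncidenceAlgebra K X) (IncidenceAlgebra K X)),
      (∀ d, z * d = d * z) ∧ θ = ↑η * z * rhoTilde K X lam hlam (kTilde K X k ↑η) := by
  obtain ⟨a, b, ha, hb⟩ := exists_fst_snd_eq_smul_one_of_central hconn x₀ hc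
  have hu : IsUnit θ.fst := isUnit_iff_isUnit_fst.1 hθ
  have h_fst : θ.fst = a • rhoLam K X lam hlam θ.fst := by
    conv_lhs => rw [h, fst_mul, fst_rhoTilde_kTilde, ha, smul_mul_assoc, one_mul]
  have ha_one : a = 1 := by
    have h' := congrArg (fun f : IncidenceAlgebra K X => f x₀ x₀) h_fst
    simp only [IncidenceAlgebra.constSMul_apply, IncidenceAlgebra.rhoLam_apply, hx₀,
      smul_eq_mul] at h'
    refine mul_right_cancel₀ (IncidenceAlgebra.apply_self_ne_zero hu x₀) ?_
    rw [one_mul, ← h']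
  rw [ha_one, one_smul] at h_fst ha
  have h_snd : θ.snd = k • rhoLam K X lam hlam θ.snd + b • θ.fst := by
    conv_lhs => rw [h, idealization_snd_mul, fst_rhoTilde_kTilde, snd_rhoTilde_kTilde, ha, hb,
      one_mul, smul_mul_assoc, one_mul, ← h_fst]
  obtain ⟨s, v, hs, ⟨v, rfl⟩, hv⟩ := IncidenceAlgebra.exists_eq_smul_mul_rhoLam hlam hinv h2
    hfix hu h_fst.symm
  set m := (2 * s)⁻¹ • (θ.snd * rhoLam K X lam hlam ↑v⁻¹) with hm
  have hm_mul : m * rhoLam K X lam hlam v = (2 * s)⁻¹ • θ.snd := by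
    rw [hm, smul_mul_assoc, mul_assoc, ← IncidenceAlgebra.rhoLam_mul hlam hinv, Units.mul_inv,
      IncidenceAlgebra.rhoLam_one hlam hinv, mul_one]
  have hmul_m : v * rhoLam K X lam hlam m = (2 * s)⁻¹ • rhoLam K X lam hlam θ.snd := by
    rw [← IncidenceAlgebra.rhoLam_smul, ← hm_mul, IncidenceAlgebra.rhoLam_mul hlam hinv,
      IncidenceAlgebra.rhoLam_rhoLam hlam hinv]
  have hη : IsUnit (inl (v : IncidenceAlgebra K X) + inr m :
      TrivSqZeroExt (IncidenceAlgebra K X) (IncidenceAlgebra K X)) := by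
    rw [isUnit_iff_isUnit_fst]
    simp
  let z : TrivSqZeroExt (IncidenceAlgebra K X) (IncidenceAlgebra K X) :=
    inl (s • 1) + inr ((s * (b / 2)) • 1)
  have hz_fst : z.fst = s • (1 : IncidenceAlgebra K X) := by simp [z]
  have hz_snd : z.snd = (s * (b / 2)) • (1 : IncidenceAlgebra K X) := by simp [z]
  refine ⟨hη.unit, z, central_of_fst_snd_eq_smul_one hz_fst hz_snd, ?_⟩
  rw [IsUnit.unit_spec]
  refine TrivSqZeroExt.ext ?_ ?_
  · rw [fst_mul, fst_mul, fst_rhoTilde_kTilde]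
    simpa [hz_fst] using hv
  · simp only [idealization_snd_mul, fst_mul, fst_rhoTilde_kTilde, snd_rhoTilde_kTilde, fst_add,
      snd_add, hz_fst, hz_snd, fst_inl, fst_inr, snd_inl, snd_inr, add_zero, zero_add,
      mul_smul_comm, smul_mul_assoc, mul_one, hm_mul, hmul_m, add_mul, zero_mul,
      smul_zero]
    have hvv : (v : IncidenceAlgebra K X) * rhoLam K X lam hlam v = s⁻¹ • θ.fst := by
      rw [hv, smul_smul, inv_mul_cancel₀ hs, one_smul]
    have hk : k • rhoLam K X lam hlam θ.snd = θ.snd - b • θ.fst := eq_sub_of_add_eq h_snd.symm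
    rw [hvv, smul_comm k, smul_comm k, hk]
    ext x y _
    simp only [IncidenceAlgebra.add_apply, IncidenceAlgebra.sub_apply,
      IncidenceAlgebra.constSMul_apply, smul_eq_mul]
    field_simp
    ring

end Idealization

/-- Assume `char K ≠ 2` and `X` is a connected locally finite poset satisfying conditions
(M) and (D).  Let `λ` be an involution on `X` with exactly one fixed point.  Then every
involution `Φ = Ψ_θ ∘ ρ̃_λ ∘ k̃δ` on `D(X,K)` with `θ` a unit and `k ∈ {-1,1}` is
equivalent via an inner automorphism to `ρ̃_λ ∘ k̃δ`: there is a unit `γ` of `D(X,K)`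
with `Ψ_γ ∘ Φ = (ρ̃_λ ∘ k̃δ) ∘ Ψ_γ`. -/
theorem classification_of_involutions_one_fixed_point
    (K X : Type*) [Field K] [PartialOrder X] [LocallyFiniteOrder X] [DecidableEq X]
    (hchar : (2 : K) ≠ 0)
    (hconn : PosetConnected X) (hM : CondM K X) (hD : CondD K X)
    (lam : X → X)
    (hlam : ∀ x y : X, x ≤ y ↔ lam y ≤ lam x)
    (hlaminvo : ∀ x : X, lam (lam x) = x)
    (hfix : ∃! x : X, lam x = x)
    (Φ : TrivSqZeroExt (IncidenceAlgebra K X) (IncidenceAlgebra K X) →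
         TrivSqZeroExt (IncidenceAlgebra K X) (IncidenceAlgebra K X))
    (θ : (TrivSqZeroExt (IncidenceAlgebra K X) (IncidenceAlgebra K X))ˣ)
    (k : K) (hk : k = 1 ∨ k = -1)
    (hΦ : ∀ d, Φ d = ↑θ * rhoTilde K X lam hlam (kTilde K X k d) * ↑θ⁻¹)
    (hΦinvo : ∀ d, Φ (Φ d) = d) :
    ∃ γ : (TrivSqZeroExt (IncidenceAlgebra K X) (IncidenceAlgebra K X))ˣ,
      ∀ d, ↑γ * Φ d * ↑γ⁻¹ = rhoTilde K X lam hlam (kTilde K X k (↑γ * d * ↑γ⁻¹)) := by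
  obtain ⟨x₀, hx₀, hfix'⟩ := hfix
  have hkk : k * k = 1 := by rcases hk with rfl | rfl <;> norm_num
  have σ_one := rhoTilde_kTilde_one hlam hlaminvo k
  have σ_mul := rhoTilde_kTilde_mul hlam hlaminvo k
  obtain ⟨c, hc, hθ⟩ := exists_central_eq_mul_of_involutive
    (σ := fun d => rhoTilde K X lam hlam (kTilde K X k d)) σ_one σ_mul
    (rhoTilde_kTilde_involutive hlam hlaminvo hkk) θ
    fun d => by simpa only [hΦ] using hΦinvo d
  obtain ⟨η, z, hz, hη⟩ := exists_eq_mul_central_mul_rhoTilde hlam hlaminvo hchar hconn hx₀ hfix'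
    k θ.isUnit hc hθ
  refine ⟨η⁻¹, fun d => ?_⟩
  rw [hΦ, inv_inv]
  exact conj_inv_eq_of_eq_mul_central_mul
    (σ := fun d => rhoTilde K X lam hlam (kTilde K X k d)) σ_one σ_mul θ η hz hη d
end

section
/- Assume char K ≠ 2 and X is a connected locally finite poset satisfying conditions (M) and (D). Let Φ₁ and Φ₂ be involutions on D(X,K). Then Φ₁ and Φ₂ are equivalent (there exists a K-algebra automorphism Ψ of D(X,K) with Ψ ∘ Φ₁ = Φ₂ ∘ Ψ) if and only if there exist an order automorphism α of X and k ∈ K* such that Φ₁ and α̃ ∘ (k̃δ) ∘ Φ₂ ∘ (k̃⁻¹δ) ∘ α̃⁻¹ are equivalent via an inner automorphism (there is a unit γ of D(X,K) with Ψ_γ ∘ Φ₁ = (α̃ ∘ (k̃δ) ∘ Φ₂ ∘ (k̃⁻¹δ) ∘ α̃⁻¹) ∘ Ψ_γ). -/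
open TrivSqZeroExt

variable (K X : Type*) [Field K] [PartialOrder X] [LocallyFiniteOrder X] [DecidableEq X]

/-- The automorphism `α̂` of `I(X,K)` induced by an order automorphism `α` of `X`:
`α̂(f)(x,y) = f(α⁻¹(x), α⁻¹(y))`. -/
def alphaHat (K X : Type*) [Field K] [PartialOrder X] [LocallyFiniteOrder X] [DecidableEq X]
    (alpha : X ≃ X) (halpha : ∀ x y : X, x ≤ y ↔ alpha x ≤ alpha y)
    (f : IncidenceAlgebra K X) : IncidenceAlgebra K X :=
  ⟨fun x y => f (alpha.symm x) (alpha.symm y),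
    fun a b hab => IncidenceAlgebra.apply_eq_zero_of_not_le
      (fun h => hab (by simpa using (halpha (alpha.symm a) (alpha.symm b)).mp h)) f⟩

/-- The automorphism `α̃` of `D(X,K)`: `(f,i) ↦ (α̂(f), α̂(i))`. -/
def alphaTilde (K X : Type*) [Field K] [PartialOrder X] [LocallyFiniteOrder X] [DecidableEq X]
    (alpha : X ≃ X) (halpha : ∀ x y : X, x ≤ y ↔ alpha x ≤ alpha y)
    (d : TrivSqZeroExt (IncidenceAlgebra K X) (IncidenceAlgebra K X)) :
    TrivSqZeroExt (IncidenceAlgebra K X) (IncidenceAlgebra K X) :=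
  inl (alphaHat K X alpha halpha d.fst) + inr (alphaHat K X alpha halpha d.snd)

/-- The inverse order automorphism also respects the order. -/
lemma symm_order_iff {X : Type*} [PartialOrder X] (alpha : X ≃ X)
    (halpha : ∀ x y : X, x ≤ y ↔ alpha x ≤ alpha y) :
    ∀ x y : X, x ≤ y ↔ alpha.symm x ≤ alpha.symm y := fun x y => by
  rw [halpha (alpha.symm x) (alpha.symm y), alpha.apply_symm_apply, alpha.apply_symm_apply]

namespace IncidenceAlgebra

variable {K X : Type*} [Field K] [PartialOrder X] [LocallyFiniteOrder X] [DecidableEq X]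

omit [DecidableEq X] in
lemma mul_apply_self (f g : IncidenceAlgebra K X) (x : X) : (f * g) x x = f x x * g x x := by
  simp

/-- The inverse of an incidence function with nonvanishing diagonal, as a bare function. -/
def leftInvFun (f : IncidenceAlgebra K X) (a : X) : X → K
  | b =>
    if a = b then (f b b)⁻¹
    else
      -(∑ x ∈ (Finset.Ico a b).attach,
          have h := Finset.mem_Ico.1 x.2
          have : (Finset.Icc a x).card < (Finset.Icc a b).card :=
            Finset.card_lt_card (Finset.Icc_ssubset_Icc_right (h.1.trans h.2.le) le_rfl h.2)
          leftInvFun f a x * f x b) * (f b b)⁻¹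
termination_by b => (Finset.Icc a b).card

lemma leftInvFun_apply (f : IncidenceAlgebra K X) (a b : X) :
    leftInvFun f a b = if a = b then (f b b)⁻¹
      else -(∑ x ∈ Finset.Ico a b, leftInvFun f a x * f x b) * (f b b)⁻¹ := by
  rw [leftInvFun, Finset.sum_attach (Finset.Ico a b) fun x => leftInvFun f a x * f x b]

/-- A left inverse of an incidence function with nonvanishing diagonal. -/
def leftInv (f : IncidenceAlgebra K X) : IncidenceAlgebra K X :=
  ⟨leftInvFun f, fun a b hab => by
    rw [leftInvFun_apply, if_neg (fun h => hab h.le), Finset.Ico_eq_empty (fun h => hab h.le)]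
    simp⟩

lemma leftInv_apply (f : IncidenceAlgebra K X) (a b : X) :
    leftInv f a b = if a = b then (f b b)⁻¹
      else -(∑ x ∈ Finset.Ico a b, leftInv f a x * f x b) * (f b b)⁻¹ :=
  leftInvFun_apply f a b

lemma leftInv_mul (f : IncidenceAlgebra K X) (hf : ∀ x, f x x ≠ 0) : leftInv f * f = 1 := by
  ext a b hab
  rw [mul_apply, one_apply]
  split_ifs with h
  · subst h
    simp [leftInv_apply f a a, hf]
  · rw [← Finset.Ico_insert_right hab, Finset.sum_insert (by simp), leftInv_apply f a b, if_neg h,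
      mul_assoc, inv_mul_cancel₀ (hf b)]
    simp

lemma isUnit_of_apply_self_ne_zero (f : IncidenceAlgebra K X) (hf : ∀ x, f x x ≠ 0) :
    IsUnit f := by
  have h1 := leftInv_mul f hf
  have h2 := leftInv_mul (leftInv f) fun x => by simp [leftInv_apply f x x, hf]
  exact ⟨⟨f, leftInv f, by rwa [left_inv_eq_right_inv h2 h1] at h2, h1⟩, rfl⟩

lemma eq_zero_of_isIdempotentElem {f : IncidenceAlgebra K X} (hf : f * f = f)
    (h : ∀ x, f x x = 0) : f = 0 := by
  have hu : IsUnit (1 - f) := isUnit_of_apply_self_ne_zero _ fun x => by simp [h]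
  refine hu.mul_left_eq_zero.mp ?_
  rw [mul_sub, hf, mul_one, sub_self]

variable (K) in
/-- The idempotent of the incidence algebra supported at `(x, x)`. -/
def diagIdem (x : X) : IncidenceAlgebra K X :=
  ⟨fun a b => if a = x ∧ b = x then 1 else 0, fun _ _ hab =>
    if_neg fun h => hab (h.1.trans h.2.symm).le⟩

omit [LocallyFiniteOrder X] in
lemma diagIdem_apply (x a b : X) : diagIdem K x a b = if a = x ∧ b = x then 1 else 0 := rfl

lemma diagIdem_mul_apply (x : X) (f : IncidenceAlgebra K X) (a b : X) :
    (diagIdem K x * f) a b = if a = x then f a b else 0 := by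
  by_cases hab : a ≤ b
  · rw [mul_apply, Finset.sum_eq_single a]
    · simp [diagIdem_apply]
    · intro c _ hc
      rw [diagIdem_apply, if_neg (fun h => hc (h.2.trans h.1.symm)), zero_mul]
    · simp [hab]
  · simp [apply_eq_zero_of_not_le hab]

lemma mul_diagIdem_apply (x : X) (f : IncidenceAlgebra K X) (a b : X) :
    (f * diagIdem K x) a b = if b = x then f a b else 0 := by
  by_cases hab : a ≤ b
  · rw [mul_apply, Finset.sum_eq_single b]
    · simp [diagIdem_apply]
    · intro c _ hc
      rw [diagIdem_apply, if_neg (fun h => hc (h.1.trans h.2.symm)), mul_zero]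
    · simp [hab]
  · simp [apply_eq_zero_of_not_le hab]

lemma diagIdem_mul_diagIdem (x y : X) :
    diagIdem K x * diagIdem K y = if x = y then diagIdem K x else 0 := by
  ext a b _
  rw [diagIdem_mul_apply]
  split_ifs <;> simp_all [diagIdem_apply]

omit [LocallyFiniteOrder X] in
lemma diagIdem_ne_zero (x : X) : diagIdem K x ≠ 0 := fun h => by
  simpa [diagIdem_apply] using congrArg (fun f : IncidenceAlgebra K X => f x x) h

lemma diagIdem_mul_mul_diagIdem (x : X) (f : IncidenceAlgebra K X) :
    diagIdem K x * f * diagIdem K x = f x x • diagIdem K x := by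
  ext a b _
  rw [mul_diagIdem_apply, diagIdem_mul_apply, constSMul_apply, diagIdem_apply]
  split_ifs <;> simp_all

lemma exists_eq_smul_one_of_comm (hconn : PosetConnected X) {f : IncidenceAlgebra K X}
    (hf : ∀ g, f * g = g * f) : ∃ c : K, f = c • 1 := by
  classical
  have hdiag : ∀ x y, x ≠ y → f x y = 0 := fun x y hxy => by
    have h := congrArg (fun g : IncidenceAlgebra K X => g x y) (hf (diagIdem K x))
    simp only [diagIdem_mul_apply, mul_diagIdem_apply, if_neg hxy.symm] at h
    simpa using h.symm
  have hle : ∀ x y, x ≤ y → f x x = f y y := fun x y hxy => by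
    have h := congrArg (fun g : IncidenceAlgebra K X => g x y) (hf (zeta K))
    simp only [mul_apply] at h
    rw [Finset.sum_eq_single_of_mem x (by simp [hxy]) fun c _ hc => by simp [hdiag x c hc.symm],
      Finset.sum_eq_single_of_mem y (by simp [hxy]) fun c _ hc => by simp [hdiag c y hc]] at h
    simpa [hxy] using h
  have hconst : ∀ x y, f x x = f y y := fun x y => by
    induction hconn x y with
    | refl => rfl
    | tail _ h ih => exact ih.trans (h.elim (hle _ _) fun h => (hle _ _ h).symm)
  rcases isEmpty_or_nonempty X with hX | ⟨⟨x⟩⟩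
  · exact ⟨0, by ext a; exact hX.elim a⟩
  · refine ⟨f x x, ?_⟩
    ext a b _
    rw [constSMul_apply, one_apply]
    split_ifs with h
    · subst h
      simp [hconst a x]
    · simp [hdiag a b h]

section Automorphism

variable (φ : IncidenceAlgebra K X ≃+* IncidenceAlgebra K X)

lemma exists_apply_self_of_map_diagIdem (hφ : ∀ (k : K) f, φ (k • f) = k • φ f) (x : X) :
    ∃ y, ∀ z, φ (diagIdem K x) z z = if z = y then 1 else 0 := by
  have hidem : φ (diagIdem K x) * φ (diagIdem K x) = φ (diagIdem K x) := by
    rw [← map_mul, diagIdem_mul_diagIdem, if_pos rfl]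
  have hval : ∀ z, φ (diagIdem K x) z z = 0 ∨ φ (diagIdem K x) z z = 1 := fun z => by
    have h := congrArg (fun f : IncidenceAlgebra K X => f z z) hidem
    rw [mul_apply_self] at h
    exact IsIdempotentElem.iff_eq_zero_or_one.mp h
  obtain ⟨y, hy⟩ : ∃ y, φ (diagIdem K x) y y = 1 := by
    by_contra! h
    have h0 := eq_zero_of_isIdempotentElem hidem fun z => (hval z).resolve_right (h z)
    exact diagIdem_ne_zero x ((map_eq_zero_iff φ φ.injective).mp h0)
  refine ⟨y, fun z => ?_⟩
  split_ifs with hz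
  · rw [hz, hy]
  · have h := congrArg φ (diagIdem_mul_mul_diagIdem x (φ.symm (diagIdem K y)))
    rw [hφ, map_mul, map_mul, RingEquiv.apply_symm_apply] at h
    have hy' := congrArg (fun f : IncidenceAlgebra K X => f y y) h
    have hz' := congrArg (fun f : IncidenceAlgebra K X => f z z) h
    simp only [mul_apply_self, constSMul_apply, diagIdem_apply, hy, hz, smul_eq_mul] at hy' hz'
    simp at hy' hz'
    rw [← hy'] at hz'
    simpa using hz'

lemma exists_equiv_map_diagIdem (hφ : ∀ (k : K) f, φ (k • f) = k • φ f) :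
    ∃ alpha : X ≃ X, ∀ x z, φ (diagIdem K x) z z = if z = alpha x then 1 else 0 := by
  have key : ∀ (ψ : IncidenceAlgebra K X ≃+* IncidenceAlgebra K X)
      (_ : ∀ (k : K) f, ψ (k • f) = k • ψ f) (a b : X → X)
      (_ : ∀ x z, ψ (diagIdem K x) z z = if z = a x then 1 else 0)
      (_ : ∀ x z, ψ.symm (diagIdem K x) z z = if z = b x then 1 else 0) (y : X), a (b y) = y := by
    intro ψ hψ a b ha hb y
    have h := congrArg ψ (diagIdem_mul_mul_diagIdem (b y) (ψ.symm (diagIdem K y)))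
    rw [hψ, map_mul, map_mul, RingEquiv.apply_symm_apply, hb] at h
    have h' := congrArg (fun f : IncidenceAlgebra K X => f (a (b y)) (a (b y))) h
    simp only [mul_apply_self, constSMul_apply, ha, diagIdem_apply] at h'
    simpa using h'
  have hφ' : ∀ (k : K) f, φ.symm (k • f) = k • φ.symm f := fun k f => by
    rw [RingEquiv.symm_apply_eq, hφ, RingEquiv.apply_symm_apply]
  choose a ha using exists_apply_self_of_map_diagIdem φ hφ
  choose b hb using exists_apply_self_of_map_diagIdem φ.symm hφ'
  exact ⟨⟨a, b, key φ.symm hφ' b a hb ha, key φ hφ a b ha hb⟩, ha⟩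

lemma exists_units_conj_map_diagIdem (alpha : X ≃ X)
    (halpha : ∀ x z, φ (diagIdem K x) z z = if z = alpha x then 1 else 0) :
    ∃ u : (IncidenceAlgebra K X)ˣ, ∀ x, ↑u * φ (diagIdem K x) * ↑u⁻¹ = diagIdem K (alpha x) := by
  let v : IncidenceAlgebra K X :=
    ⟨fun a b => φ (diagIdem K (alpha.symm a)) a b, fun a b hab => apply_eq_zero_of_not_le hab _⟩
  have hv : ∀ a b, v a b = φ (diagIdem K (alpha.symm a)) a b := fun _ _ => rfl
  obtain ⟨u, hu⟩ : IsUnit v := isUnit_of_apply_self_ne_zero _ fun x => by simp [hv, halpha]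
  refine ⟨u, fun x => ?_⟩
  rw [Units.mul_inv_eq_iff_eq_mul, hu]
  ext a b _
  have h : (v * φ (diagIdem K x)) a b
      = (φ (diagIdem K (alpha.symm a)) * φ (diagIdem K x)) a b := rfl
  rw [h, ← map_mul, diagIdem_mul_diagIdem, diagIdem_mul_apply, hv]
  simp only [alpha.symm_apply_eq]
  split_ifs with h
  · rw [h, alpha.symm_apply_apply]
  · rw [map_zero, zero_apply]

/-- An automorphism permuting the diagonal idempotents permutes the order and acts on entries
by a multiplicative function. -/
lemma exists_multiplicative_of_map_diagIdem (hφ : ∀ (k : K) f, φ (k • f) = k • φ f)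
    (alpha : X ≃ X) (halpha : ∀ x, φ (diagIdem K x) = diagIdem K (alpha x)) :
    (∀ x y, x ≤ y ↔ alpha x ≤ alpha y) ∧ ∃ σ : X → X → K, (∀ x y, x ≤ y → σ x y ≠ 0) ∧
      (∀ x y z, x ≤ y → y ≤ z → σ x y * σ y z = σ x z) ∧
      ∀ f x y, φ f (alpha x) (alpha y) = σ x y * f x y := by
  classical
  have corner : ∀ (f : IncidenceAlgebra K X) x y,
      diagIdem K x * f * diagIdem K y = f x y • (diagIdem K x * zeta K * diagIdem K y) := by
    intro f x y
    ext a b hab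
    simp only [constSMul_apply, mul_diagIdem_apply, diagIdem_mul_apply, zeta_of_le hab]
    split_ifs <;> simp_all
  have hmap : ∀ f x y, φ f (alpha x) (alpha y) = φ (zeta K) (alpha x) (alpha y) * f x y := by
    intro f x y
    have h := congrArg (fun f : IncidenceAlgebra K X => f (alpha x) (alpha y))
      (congrArg φ (corner f x y))
    simp only [hφ, map_mul, halpha, mul_diagIdem_apply, diagIdem_mul_apply, constSMul_apply] at h
    simpa [mul_comm] using h
  have hne : ∀ x y, x ≤ y → φ (zeta K) (alpha x) (alpha y) ≠ 0 := by
    intro x y hxy h0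
    have h1 : φ (diagIdem K x * zeta K * diagIdem K y) = 0 := by
      ext a b _
      simp only [map_mul, halpha, mul_diagIdem_apply, diagIdem_mul_apply]
      split_ifs with hb ha
      · rw [ha, hb, h0, zero_apply]
      all_goals rw [zero_apply]
    have h2 := congrArg (fun f : IncidenceAlgebra K X => f x y)
      ((map_eq_zero_iff φ φ.injective).mp h1)
    simp only [mul_diagIdem_apply, diagIdem_mul_apply, zeta_of_le hxy] at h2
    simp at h2
  refine ⟨fun x y => ⟨fun h => le_of_ne_zero (hne x y h), fun h => ?_⟩,
    fun x y => φ (zeta K) (alpha x) (alpha y), hne, fun x y z hxy hyz => ?_, hmap⟩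
  · have h1 := hmap (φ.symm (zeta K)) x y
    rw [RingEquiv.apply_symm_apply, zeta_of_le h] at h1
    exact le_of_ne_zero (f := φ.symm (zeta K)) fun h0 => by simp [h0] at h1
  · have entry : ∀ (f g : IncidenceAlgebra K X) (a b c : X), a ≤ b → b ≤ c →
        (f * diagIdem K b * g) a c = f a b * g b c := by
      intro f g a b c hab hbc
      rw [mul_apply, Finset.sum_eq_single_of_mem b (by simp [hab, hbc])]
      · rw [mul_diagIdem_apply, if_pos rfl]
      · intro d _ hd
        rw [mul_diagIdem_apply, if_neg hd, zero_mul]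
    have h := hmap (zeta K * diagIdem K y * zeta K) x z
    rw [map_mul, map_mul, halpha,
      entry _ _ _ _ _ (le_of_ne_zero (hne x y hxy)) (le_of_ne_zero (hne y z hyz)),
      entry _ _ _ _ _ hxy hyz, zeta_of_le hxy, zeta_of_le hyz] at h
    simpa using h

end Automorphism

end IncidenceAlgebra

section AlphaHat

variable {K X : Type*} [Field K] [PartialOrder X] [LocallyFiniteOrder X] [DecidableEq X]
  (alpha : X ≃ X) (halpha : ∀ x y : X, x ≤ y ↔ alpha x ≤ alpha y)

lemma alphaHat_apply (f : IncidenceAlgebra K X) (x y : X) :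
    alphaHat K X alpha halpha f x y = f (alpha.symm x) (alpha.symm y) := rfl

lemma alphaHat_alphaHat_symm (f : IncidenceAlgebra K X) :
    alphaHat K X alpha halpha (alphaHat K X alpha.symm (symm_order_iff alpha halpha) f) = f := by
  ext x y _
  simp [alphaHat_apply]

lemma alphaHat_symm_alphaHat (f : IncidenceAlgebra K X) :
    alphaHat K X alpha.symm (symm_order_iff alpha halpha) (alphaHat K X alpha halpha f) = f := by
  ext x y _
  simp [alphaHat_apply]

lemma alphaHat_add (f g : IncidenceAlgebra K X) :
    alphaHat K X alpha halpha (f + g) = alphaHat K X alpha halpha f + alphaHat K X alpha halpha g :=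
  rfl

lemma alphaHat_smul (k : K) (f : IncidenceAlgebra K X) :
    alphaHat K X alpha halpha (k • f) = k • alphaHat K X alpha halpha f :=
  rfl

lemma alphaHat_mul (f g : IncidenceAlgebra K X) :
    alphaHat K X alpha halpha (f * g) =
      alphaHat K X alpha halpha f * alphaHat K X alpha halpha g := by
  ext x y _
  rw [alphaHat_apply, IncidenceAlgebra.mul_apply, IncidenceAlgebra.mul_apply]
  refine Finset.sum_equiv alpha (fun z => ?_) fun z _ => ?_
  · rw [Finset.mem_Icc, Finset.mem_Icc, halpha, halpha z, alpha.apply_symm_apply,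
      alpha.apply_symm_apply]
  · simp [alphaHat_apply]

/-- `alphaHat` as a ring automorphism. -/
def alphaHatEquiv : IncidenceAlgebra K X ≃+* IncidenceAlgebra K X where
  toFun := alphaHat K X alpha halpha
  invFun := alphaHat K X alpha.symm (symm_order_iff alpha halpha)
  left_inv := alphaHat_symm_alphaHat alpha halpha
  right_inv := alphaHat_alphaHat_symm alpha halpha
  map_mul' := alphaHat_mul alpha halpha
  map_add' := alphaHat_add alpha halpha

lemma alphaHatEquiv_apply (f : IncidenceAlgebra K X) :
    alphaHatEquiv alpha halpha f = alphaHat K X alpha halpha f := rfl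

/-- Every linear automorphism of the incidence algebra is an inner automorphism followed by the
automorphism induced by an order automorphism. -/
lemma exists_eq_alphaHat_conj (hM : CondM K X)
    (φ : IncidenceAlgebra K X ≃+* IncidenceAlgebra K X) (hφ : ∀ (k : K) f, φ (k • f) = k • φ f) :
    ∃ (alpha : X ≃ X) (halpha : ∀ x y : X, x ≤ y ↔ alpha x ≤ alpha y)
      (w : (IncidenceAlgebra K X)ˣ), ∀ f, φ f = alphaHat K X alpha halpha (↑w * f * ↑w⁻¹) := by
  obtain ⟨alpha, hdiag⟩ := IncidenceAlgebra.exists_equiv_map_diagIdem φ hφ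
  obtain ⟨u, hu⟩ := IncidenceAlgebra.exists_units_conj_map_diagIdem φ alpha hdiag
  let conj : IncidenceAlgebra K X ≃+* IncidenceAlgebra K X :=
    MulSemiringAction.toRingEquiv (ConjAct (IncidenceAlgebra K X)ˣ) _ (ConjAct.toConjAct u)
  have hconj : ∀ f, conj f = ↑u * f * ↑u⁻¹ := fun f => rfl
  obtain ⟨halpha, σ, hσ, hσm, happ⟩ :=
    IncidenceAlgebra.exists_multiplicative_of_map_diagIdem (φ.trans conj)
      (fun k f => by simp [hconj, hφ]) alpha hu
  obtain ⟨v, hv⟩ := hM σ hσ hσm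
  have hφ' : ∀ f, ↑u * φ f * ↑u⁻¹ =
      alphaHat K X alpha halpha (↑v * f * ↑v⁻¹ : IncidenceAlgebra K X) := fun f => by
    ext x y hxy
    have h := happ f (alpha.symm x) (alpha.symm y)
    rw [alpha.apply_symm_apply, alpha.apply_symm_apply] at h
    rw [alphaHat_apply, hv _ _ _ ((symm_order_iff alpha halpha x y).mp hxy), ← h]
    rfl
  let w : (IncidenceAlgebra K X)ˣ :=
    Units.map (alphaHatEquiv alpha halpha).symm.toMonoidHom u⁻¹ * v
  have hw : alphaHatEquiv alpha halpha (w : IncidenceAlgebra K X) =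
      ↑u⁻¹ * alphaHatEquiv alpha halpha (v : IncidenceAlgebra K X) := by
    simp [w]
  have hw' : alphaHatEquiv alpha halpha (↑w⁻¹ : IncidenceAlgebra K X) =
      alphaHatEquiv alpha halpha (↑v⁻¹ : IncidenceAlgebra K X) * ↑u := by
    simp [w]
  refine ⟨alpha, halpha, w, fun f => ?_⟩
  have h := hφ' f
  rw [← alphaHatEquiv_apply] at h ⊢
  rw [map_mul, map_mul] at h ⊢
  rw [hw, hw']
  calc φ f = ↑u⁻¹ * (↑u * φ f * ↑u⁻¹) * ↑u := by simp [mul_assoc]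
    _ = _ := by rw [h]; simp only [mul_assoc]

end AlphaHat

section TrivSqZero

variable {K X : Type*} [Field K] [PartialOrder X] [LocallyFiniteOrder X] [DecidableEq X]

local notation "D" => TrivSqZeroExt (IncidenceAlgebra K X) (IncidenceAlgebra K X)

lemma fst_alphaTilde (alpha : X ≃ X) (halpha : ∀ x y : X, x ≤ y ↔ alpha x ≤ alpha y) (d : D) :
    (alphaTilde K X alpha halpha d).fst = alphaHat K X alpha halpha d.fst := by
  simp [alphaTilde]

lemma snd_alphaTilde (alpha : X ≃ X) (halpha : ∀ x y : X, x ≤ y ↔ alpha x ≤ alpha y) (d : D) :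
    (alphaTilde K X alpha halpha d).snd = alphaHat K X alpha halpha d.snd := by
  simp [alphaTilde]

lemma fst_kTilde (k : K) (d : D) : (kTilde K X k d).fst = d.fst := by
  simp [kTilde]

lemma snd_kTilde (k : K) (d : D) : (kTilde K X k d).snd = k • d.snd := by
  simp [kTilde]

lemma kTilde_add (k : K) (u v : D) :
    kTilde K X k (u + v) = kTilde K X k u + kTilde K X k v := by
  ext1 <;> simp [fst_kTilde, snd_kTilde]

lemma kTilde_smul (k c : K) (u : D) : kTilde K X k (c • u) = c • kTilde K X k u := by
  ext1 <;> simp [fst_kTilde, snd_kTilde, smul_comm k c]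

lemma kTilde_mul (k : K) (u v : D) :
    kTilde K X k (u * v) = kTilde K X k u * kTilde K X k v := by
  ext1 <;> simp [fst_kTilde, snd_kTilde]

lemma kTilde_inv_kTilde {k : K} (hk : k ≠ 0) (u : D) : kTilde K X k⁻¹ (kTilde K X k u) = u := by
  ext1 <;> simp [fst_kTilde, snd_kTilde, hk]

lemma kTilde_kTilde_inv {k : K} (hk : k ≠ 0) (u : D) : kTilde K X k (kTilde K X k⁻¹ u) = u := by
  ext1 <;> simp [fst_kTilde, snd_kTilde, hk]

variable (alpha : X ≃ X) (halpha : ∀ x y : X, x ≤ y ↔ alpha x ≤ alpha y)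

lemma alphaTilde_add (u v : D) : alphaTilde K X alpha halpha (u + v) =
    alphaTilde K X alpha halpha u + alphaTilde K X alpha halpha v := by
  ext1 <;> simp [fst_alphaTilde, snd_alphaTilde, alphaHat_add]

lemma alphaTilde_smul (c : K) (u : D) :
    alphaTilde K X alpha halpha (c • u) = c • alphaTilde K X alpha halpha u := by
  ext1 <;> simp [fst_alphaTilde, snd_alphaTilde, alphaHat_smul]

lemma alphaTilde_mul (u v : D) : alphaTilde K X alpha halpha (u * v) =
    alphaTilde K X alpha halpha u * alphaTilde K X alpha halpha v := by
  ext1 <;> simp [fst_alphaTilde, snd_alphaTilde, alphaHat_mul, alphaHat_add]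

lemma alphaTilde_symm_alphaTilde (u : D) : alphaTilde K X alpha.symm (symm_order_iff alpha halpha)
    (alphaTilde K X alpha halpha u) = u := by
  ext1 <;> simp [fst_alphaTilde, snd_alphaTilde, alphaHat_symm_alphaHat]

lemma alphaTilde_alphaTilde_symm (u : D) : alphaTilde K X alpha halpha
    (alphaTilde K X alpha.symm (symm_order_iff alpha halpha) u) = u := by
  ext1 <;> simp [fst_alphaTilde, snd_alphaTilde, alphaHat_alphaHat_symm]

/-- A ring automorphism of `D(X,K)` multiplies `inr 1` by a nonzero scalar. -/
lemma exists_map_inr_one (hconn : PosetConnected X) (Ψ : D ≃+* D) :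
    ∃ k : K, k ≠ 0 ∧ Ψ (inr 1) = inr (k • 1) := by
  rcases isEmpty_or_nonempty X with hX | hX
  · exact ⟨1, one_ne_zero, by ext x <;> exact hX.elim x⟩
  obtain ⟨x⟩ := hX
  have hcomm : ∀ d, Ψ (inr 1) * d = d * Ψ (inr 1) := fun d => by
    obtain ⟨d, rfl⟩ := Ψ.surjective d
    rw [← map_mul, ← map_mul]
    congr 1
    ext1 <;> simp
  have hsq : Ψ (inr 1) * Ψ (inr 1) = 0 := by
    rw [← map_mul, inr_mul_inr, map_zero]
  obtain ⟨c, hc⟩ := IncidenceAlgebra.exists_eq_smul_one_of_comm hconn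
    (f := (Ψ (inr 1)).fst) fun g => by simpa using congrArg fst (hcomm (inl g))
  obtain ⟨k, hk⟩ := IncidenceAlgebra.exists_eq_smul_one_of_comm hconn
    (f := (Ψ (inr 1)).snd) fun g => by simpa using congrArg snd (hcomm (inl g))
  have hc0 : c = 0 := by
    have h := congrArg fst hsq
    rw [fst_mul, hc] at h
    simpa using congrArg (fun f : IncidenceAlgebra K X => f x x) h
  have hΨ : Ψ (inr 1) = inr (k • 1) := by
    ext1
    · rw [hc, hc0, zero_smul, fst_inr]
    · rw [hk, snd_inr]
  refine ⟨k, fun h0 => ?_, hΨ⟩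
  rw [h0, zero_smul, inr_zero, map_eq_zero_iff Ψ Ψ.injective] at hΨ
  simpa using congrArg (fun f : IncidenceAlgebra K X => f x x) (inr_injective hΨ)

/-- Every linear automorphism of `D(X,K)` is an inner automorphism followed by `alphaTilde` and
`kTilde`. -/
lemma exists_eq_kTilde_alphaTilde_conj (hconn : PosetConnected X) (hM : CondM K X)
    (hD : CondD K X) (Ψ : D ≃+* D) (hΨ : ∀ (k : K) u, Ψ (k • u) = k • Ψ u) :
    ∃ (alpha : X ≃ X) (halpha : ∀ x y : X, x ≤ y ↔ alpha x ≤ alpha y) (k : K),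
      k ≠ 0 ∧ ∃ γ : Dˣ, ∀ d, Ψ d =
        kTilde K X k (alphaTilde K X alpha halpha (↑γ * d * ↑γ⁻¹)) := by
  obtain ⟨k, hk, hk1⟩ := exists_map_inr_one hconn Ψ
  have hinr : ∀ f, Ψ (inr f) = inr (k • (Ψ (inl f)).fst) := fun f => by
    have h : (inr f : D) = inr 1 * inl f := by ext1 <;> simp
    rw [h, map_mul, hk1]
    ext1 <;> simp
  have hdecomp : ∀ d, Ψ d = Ψ (inl d.fst) + inr (k • (Ψ (inl d.snd)).fst) := fun d => by
    rw [← hinr, ← map_add, inl_fst_add_inr_snd_eq]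
  let φ₀ : IncidenceAlgebra K X →+* IncidenceAlgebra K X :=
    ((fstHom K _ _).toRingHom.comp Ψ.toRingHom).comp (inlHom _ _)
  have hφ₀ : ∀ f, φ₀ f = (Ψ (inl f)).fst := fun f => rfl
  have hbij : Function.Bijective φ₀ := by
    refine ⟨(injective_iff_map_eq_zero φ₀).mpr fun f hf => ?_, fun g => ?_⟩
    · have h := hinr f
      rw [← hφ₀, hf, smul_zero, inr_zero, map_eq_zero_iff Ψ Ψ.injective] at h
      exact inr_injective h
    · obtain ⟨d, hd⟩ := Ψ.surjective (inl g)
      refine ⟨d.fst, ?_⟩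
      have h := congrArg fst (hdecomp d)
      simpa [hd, hφ₀] using h.symm
  let φ := RingEquiv.ofBijective φ₀ hbij
  have hφ : ∀ f, φ f = (Ψ (inl f)).fst := fun f => rfl
  have hφsmul : ∀ (c : K) f, φ (c • f) = c • φ f := fun c f => by
    rw [hφ, inl_smul, hΨ, fst_smul, hφ]
  have hφsymm : ∀ (c : K) f, φ.symm (c • f) = c • φ.symm f := fun c f => by
    rw [RingEquiv.symm_apply_eq, hφsmul, RingEquiv.apply_symm_apply]
  obtain ⟨i, hi⟩ := hD (fun f => φ.symm (Ψ (inl f)).snd)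
    (fun f g => by simp only [inl_add, map_add, snd_add])
    (fun c f => by simp only [inl_smul, hΨ, snd_smul, hφsymm])
    (fun f g => by
      rw [RingEquiv.symm_apply_eq, inl_mul, map_mul, snd_mul, map_add, map_mul, map_mul,
        RingEquiv.apply_symm_apply, RingEquiv.apply_symm_apply, hφ, hφ, add_comm, smul_eq_mul,
        op_smul_eq_mul])
  obtain ⟨alpha, halpha, w, hw⟩ := exists_eq_alphaHat_conj hM φ hφsmul
  let m : D := inr (k⁻¹ • i)
  let n : Dˣ := ⟨1 - m, 1 + m, by ext1 <;> simp [m], by ext1 <;> simp [m]⟩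
  refine ⟨alpha, halpha, k, hk, Units.map (inlHom _ _).toMonoidHom w * n, fun d => ?_⟩
  have hsnd : (Ψ (inl d.fst)).snd = φ (d.fst * i - i * d.fst) := by
    rw [← hi, RingEquiv.apply_symm_apply]
  rw [hdecomp d]
  ext1
  · rw [fst_kTilde, fst_alphaTilde, fst_add, fst_inr, add_zero, ← hφ, hw]
    simp [n, m]
  · rw [snd_kTilde, snd_alphaTilde, snd_add, snd_inr, hsnd, ← hφ, ← hφsmul, ← map_add, hw,
      ← alphaHat_smul]
    congr 1
    simp [n, m, mul_add, add_mul, mul_sub, sub_mul, smul_add, smul_sub, mul_assoc, hk]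
    abel

end TrivSqZero

/-- Assume `char K ≠ 2` and `X` is a connected locally finite poset satisfying conditions
(M) and (D).  Two involutions `Φ₁` and `Φ₂` on `D(X,K)` are equivalent (conjugate by a
`K`-algebra automorphism of `D(X,K)`) if and only if there exist an order automorphism
`α` of `X` and `k ∈ K*` such that `Φ₁` and
`α̃ ∘ k̃δ ∘ Φ₂ ∘ k̃⁻¹δ ∘ α̃⁻¹` are equivalent via an inner automorphism. -/
theorem involutions_equivalent_iff_inner_equivalent_up_to_aut
    (K X : Type*) [Field K] [PartialOrder X] [LocallyFiniteOrder X] [DecidableEq X]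
    (hchar : (2 : K) ≠ 0)
    (hconn : PosetConnected X) (hM : CondM K X) (hD : CondD K X)
    (Φ₁ Φ₂ : TrivSqZeroExt (IncidenceAlgebra K X) (IncidenceAlgebra K X) →
             TrivSqZeroExt (IncidenceAlgebra K X) (IncidenceAlgebra K X))
    (h1add : ∀ u v, Φ₁ (u + v) = Φ₁ u + Φ₁ v)
    (h1smul : ∀ (k : K) u, Φ₁ (k • u) = k • Φ₁ u)
    (h1anti : ∀ u v, Φ₁ (u * v) = Φ₁ v * Φ₁ u)
    (h1bij : Function.Bijective Φ₁)
    (h1invo : ∀ u, Φ₁ (Φ₁ u) = u)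
    (h2add : ∀ u v, Φ₂ (u + v) = Φ₂ u + Φ₂ v)
    (h2smul : ∀ (k : K) u, Φ₂ (k • u) = k • Φ₂ u)
    (h2anti : ∀ u v, Φ₂ (u * v) = Φ₂ v * Φ₂ u)
    (h2bij : Function.Bijective Φ₂)
    (h2invo : ∀ u, Φ₂ (Φ₂ u) = u) :
    (∃ Ψ : TrivSqZeroExt (IncidenceAlgebra K X) (IncidenceAlgebra K X) →
           TrivSqZeroExt (IncidenceAlgebra K X) (IncidenceAlgebra K X),
        Function.Bijective Ψ ∧ (∀ u v, Ψ (u + v) = Ψ u + Ψ v) ∧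
        (∀ (k : K) u, Ψ (k • u) = k • Ψ u) ∧ (∀ u v, Ψ (u * v) = Ψ u * Ψ v) ∧
        ∀ d, Ψ (Φ₁ d) = Φ₂ (Ψ d)) ↔
      (∃ (alpha : X ≃ X) (halpha : ∀ x y : X, x ≤ y ↔ alpha x ≤ alpha y) (k : K),
        k ≠ 0 ∧
        ∃ γ : (TrivSqZeroExt (IncidenceAlgebra K X) (IncidenceAlgebra K X))ˣ,
          ∀ d, ↑γ * Φ₁ d * ↑γ⁻¹ =
            alphaTilde K X alpha halpha
              (kTilde K X k
                (Φ₂ (kTilde K X k⁻¹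
                  (alphaTilde K X alpha.symm (symm_order_iff alpha halpha)
                    (↑γ * d * ↑γ⁻¹)))))) := by
  constructor
  · rintro ⟨Ψ, hbij, hadd, hsmul, hmul, hΨ⟩
    let e : TrivSqZeroExt (IncidenceAlgebra K X) (IncidenceAlgebra K X) ≃+*
        TrivSqZeroExt (IncidenceAlgebra K X) (IncidenceAlgebra K X) :=
      { Equiv.ofBijective Ψ hbij with map_mul' := hmul, map_add' := hadd }
    obtain ⟨alpha, halpha, k, hk, γ, hγ⟩ := exists_eq_kTilde_alphaTilde_conj hconn hM hD e hsmul
    replace hγ : ∀ d, Ψ d = kTilde K X k (alphaTilde K X alpha halpha (↑γ * d * ↑γ⁻¹)) := hγ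
    refine ⟨alpha.symm, symm_order_iff alpha halpha, k⁻¹, inv_ne_zero hk, γ, fun d => ?_⟩
    have h := hΨ d
    rw [hγ d, hγ (Φ₁ d)] at h
    rw [inv_inv]
    simp only [Equiv.symm_symm]
    rw [← h, kTilde_inv_kTilde hk, alphaTilde_symm_alphaTilde]
  · rintro ⟨alpha, halpha, k, hk, γ, hγ⟩
    refine ⟨fun d => kTilde K X k⁻¹ (alphaTilde K X alpha.symm (symm_order_iff alpha halpha)
      (↑γ * d * ↑γ⁻¹)), ⟨fun u v huv => ?_, fun d => ?_⟩, fun u v => ?_, fun c u => ?_,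
      fun u v => ?_, fun d => ?_⟩
    · have h := congrArg (alphaTilde K X alpha halpha) (congrArg (kTilde K X k) huv)
      simpa [kTilde_kTilde_inv hk, alphaTilde_alphaTilde_symm] using h
    · refine ⟨↑γ⁻¹ * alphaTilde K X alpha halpha (kTilde K X k d) * ↑γ, ?_⟩
      simp [mul_assoc, alphaTilde_symm_alphaTilde, kTilde_inv_kTilde hk]
    · simp only [mul_add, add_mul, alphaTilde_add, kTilde_add]
    · have h : ↑γ * (c • u) * ↑γ⁻¹ = c • (↑γ * u * ↑γ⁻¹) := by
        ext1 <;> simp [mul_assoc, mul_add, smul_add]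
      simp only [h, alphaTilde_smul, kTilde_smul]
    · rw [← kTilde_mul, ← alphaTilde_mul]
      simp [mul_assoc]
    · simp only [hγ d, alphaTilde_symm_alphaTilde, kTilde_inv_kTilde hk]
end
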